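/- Let 𝒜 be a semiprime f-algebra and let p ∈ ℕ with p ≥ 2. If φ ∈ Φ₃(𝒜) possesses a p-th root φ^(1/p) in 𝒜 (an element b with b^p = φ), then φ^(1/p) ∈ Φ₃(𝒜); in particular, if φ > 0 is self-majorizing and has a positive p-th root, then that root is self-majorizing. -/

import Mathlib

namespace FiniteElementsPaper

/-- Product of `p` factors `φ 0 * φ 1 * ⋯ * φ (p-1)` in a (possibly non-unital)
multiplicative structure; junk value `0` when `p = 0`. -/
def mulProd {A : Type*} [Mul A] [Zero A] : (p : ℕ) → (Fin p → A) → A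
  | 0, _ => 0
  | q + 1, φ => Fin.foldl q (fun acc i => acc * φ i.succ) (φ 0)

/-- `p`-th power `a^p` (junk value `0` for `p = 0`). -/
def mpow {A : Type*} [Mul A] [Zero A] (a : A) (p : ℕ) : A :=
  mulProd p (fun _ => a)

/-- The set `Π_p(𝒜)` of all `p`-fold products. -/
def piSet (A : Type*) [Mul A] [Zero A] (p : ℕ) : Set A :=
  {x | ∃ φ : Fin p → A, x = mulProd p φ}

variable {A : Type*} [Lattice A] [AddCommGroup A] [Module ℝ A]

/-- `z` is a majorant of `φ`: `z ≥ 0` and for every `x` there is `c > 0` with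
`|x| ⊓ n • |φ| ≤ c • z` for all `n`. -/
def IsMajorant (z φ : A) : Prop :=
  0 ≤ z ∧ ∀ x : A, ∃ c : ℝ, 0 < c ∧ ∀ n : ℕ, |x| ⊓ n • |φ| ≤ c • z

/-- `φ` is a finite element. -/
def IsFiniteElt (φ : A) : Prop := ∃ z : A, IsMajorant z φ

/-- `φ` is a totally finite element: it has a majorant which is itself finite. -/
def IsTotallyFiniteElt (φ : A) : Prop := ∃ z : A, IsMajorant z φ ∧ IsFiniteElt z

/-- `φ` is self-majorizing: `|φ|` is a majorant of `φ`. -/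
def IsSelfMajorizing (φ : A) : Prop := IsMajorant |φ| φ

/-- `φ ∈ Φ₃(A) = S₊(A) - S₊(A)`. -/
def InPhi3 (φ : A) : Prop :=
  ∃ s t : A, 0 ≤ s ∧ 0 ≤ t ∧ IsSelfMajorizing s ∧ IsSelfMajorizing t ∧ φ = s - t

/-- `w` is a majorant of `φ` relative to the subset `S` (all lattice operations
computed in the ambient algebra). -/
def IsMajorantIn (S : Set A) (w φ : A) : Prop :=
  0 ≤ w ∧ ∀ x ∈ S, ∃ c : ℝ, 0 < c ∧ ∀ n : ℕ, |x| ⊓ n • |φ| ≤ c • w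

/-- `φ` is a finite element of the sublattice `S` (majorant required to lie in `S`). -/
def IsFiniteEltIn (S : Set A) (φ : A) : Prop := ∃ w ∈ S, IsMajorantIn S w φ

/-- `φ` is a totally finite element of the sublattice `S`. -/
def IsTotallyFiniteEltIn (S : Set A) (φ : A) : Prop :=
  ∃ w ∈ S, IsMajorantIn S w φ ∧ IsFiniteEltIn S w

/-- `φ` is self-majorizing in the sublattice `S`. -/
def IsSelfMajorizingIn (S : Set A) (φ : A) : Prop := IsMajorantIn S |φ| φ

/-- `φ ∈ Φ₃(S) = S₊(S) - S₊(S)` for the sublattice `S`. -/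
def InPhi3In (S : Set A) (φ : A) : Prop :=
  ∃ s t : A, s ∈ S ∧ t ∈ S ∧ 0 ≤ s ∧ 0 ≤ t ∧
    IsSelfMajorizingIn S s ∧ IsSelfMajorizingIn S t ∧ φ = s - t

variable (A) in
/-- Archimedean ℓ-algebra structure: an Archimedean vector lattice together with an
associative bilinear multiplication whose product of positive elements is positive. -/
structure IsLAlgebra [Mul A] : Prop where
  add_le_add_left : ∀ a b : A, a ≤ b → ∀ c : A, c + a ≤ c + b
  smul_le_smul : ∀ (r : ℝ) (a b : A), 0 ≤ r → a ≤ b → r • a ≤ r • b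
  archimedean : ∀ a b : A, 0 ≤ a → (∀ n : ℕ, n • a ≤ b) → a = 0
  mul_assoc : ∀ a b c : A, a * b * c = a * (b * c)
  left_distrib : ∀ a b c : A, a * (b + c) = a * b + a * c
  right_distrib : ∀ a b c : A, (a + b) * c = a * c + b * c
  smul_mul : ∀ (r : ℝ) (a b : A), (r • a) * b = r • (a * b)
  mul_smul : ∀ (r : ℝ) (a b : A), a * (r • b) = r • (a * b)
  mul_nonneg : ∀ a b : A, 0 ≤ a → 0 ≤ b → 0 ≤ a * b

variable (A) in
/-- A `d`-algebra: ℓ-algebra in which `a ⊓ b = 0` implies `(a*c) ⊓ (b*c) = (c*a) ⊓ (c*b) = 0`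
for all `c ≥ 0`. -/
structure IsDAlgebra [Mul A] extends IsLAlgebra A : Prop where
  d_prop : ∀ a b c : A, a ⊓ b = 0 → 0 ≤ c → (a * c) ⊓ (b * c) = 0 ∧ (c * a) ⊓ (c * b) = 0

variable (A) in
/-- An `f`-algebra: ℓ-algebra in which `a ⊓ b = 0` implies `(a*c) ⊓ b = (c*a) ⊓ b = 0`
for all `c ≥ 0`. -/
structure IsFAlgebra [Mul A] extends IsLAlgebra A : Prop where
  f_prop : ∀ a b c : A, a ⊓ b = 0 → 0 ≤ c → (a * c) ⊓ b = 0 ∧ (c * a) ⊓ b = 0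

/-- `e` is a multiplicative unit. -/
def IsMulUnit [Mul A] (e : A) : Prop := ∀ a : A, a * e = a ∧ e * a = a

/-- `e` is an order unit. -/
def IsOrderUnit (e : A) : Prop := 0 ≤ e ∧ ∀ x : A, ∃ l : ℝ, 0 ≤ l ∧ |x| ≤ l • e

variable (A) in
/-- The algebra is semiprime: `0` is its only nilpotent element. -/
def IsSemiprime [Mul A] [Zero A] : Prop :=
  ∀ (a : A) (n : ℕ), 0 < n → mpow a n = 0 → a = 0

variable (A) in
/-- The vector lattice is uniformly complete. -/
def UniformlyComplete : Prop :=
  ∀ u : A, 0 ≤ u → ∀ f : ℕ → A,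
    (∀ ε : ℝ, 0 < ε → ∃ K : ℕ, ∀ m n : ℕ, K ≤ m → K ≤ n → |f m - f n| ≤ ε • u) →
    ∃ a : A, ∀ ε : ℝ, 0 < ε → ∃ K : ℕ, ∀ n : ℕ, K ≤ n → |f n - a| ≤ ε • u

variable (A) in
/-- The weak factorization property: every element is dominated by a product. -/
def WeakFactorization [Mul A] : Prop := ∀ a : A, ∃ b c : A, a ≤ b * c


theorem inf_eq_zero_of_le {A : Type*} [Lattice A] [Zero A] {a b c : A}
    (h : a ⊓ b = 0) (hb : 0 ≤ b) (hc : 0 ≤ c) (hca : c ≤ a) :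
    c ⊓ b = 0 :=
  le_antisymm ((inf_le_inf_right b hca).trans h.le) (le_inf hc hb)

section OrderedGroup

variable {A : Type*} [Lattice A] [AddCommGroup A] [IsOrderedAddMonoid A]

theorem add_inf_eq_zero {a b c : A} (ha : 0 ≤ a) (hb : 0 ≤ b) (hc : 0 ≤ c)
    (hac : a ⊓ c = 0) (hbc : b ⊓ c = 0) : (a + b) ⊓ c = 0 := by
  refine le_antisymm ?_ (le_inf (add_nonneg ha hb) hc)
  have h : (a + b) ⊓ c - b ≤ a ⊓ c :=
    le_inf (sub_le_iff_le_add.2 inf_le_left) ((sub_le_self _ hb).trans inf_le_right)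
  rw [hac, sub_nonpos] at h
  exact (le_inf h inf_le_right).trans hbc.le

theorem abs_sub_of_inf_eq_zero {a b : A} (h : a ⊓ b = 0) : |a - b| = a + b := by
  have h' := inf_add_sup a b
  rw [h, zero_add] at h'
  rw [← sup_sub_inf_eq_abs_sub, inf_comm, sup_comm, h, sub_zero, h']

theorem posPart_inf_eq_zero {a s : A} (hs : 0 ≤ s) (h : a ⊓ s ≤ 0) : a⁺ ⊓ s = 0 := by
  refine le_antisymm ?_ (le_inf (posPart_nonneg a) hs)
  let : DistribLattice A := AddCommGroup.toDistribLattice A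
  rw [posPart_def, inf_sup_right]
  exact sup_le h inf_le_left

theorem inf_add_le_inf_add_inf {a b c : A} (ha : 0 ≤ a) (hb : 0 ≤ b) (hc : 0 ≤ c) :
    a ⊓ (b + c) ≤ a ⊓ b + a ⊓ c := by
  rw [← sub_le_iff_le_add]
  refine le_inf ((sub_le_self _ (le_inf ha hc)).trans inf_le_left) ?_
  rw [sub_le_comm]
  refine le_inf ((sub_le_self _ hb).trans inf_le_left) ?_
  rw [sub_le_iff_le_add, add_comm c b]
  exact inf_le_right

end OrderedGroup

theorem mpow_one {A : Type*} [Mul A] [Zero A] (a : A) : mpow a 1 = a := rfl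

theorem mpow_add_two {A : Type*} [Mul A] [Zero A] (a : A) (q : ℕ) :
    mpow a (q + 2) = mpow a (q + 1) * a := by
  simp [mpow, mulProd, Fin.foldl_succ_last]

section SelfMajorizing

variable {A : Type*} [Lattice A] [AddCommGroup A] [Module ℝ A]

theorem isSelfMajorizing_iff [IsOrderedAddMonoid A]
    (hsmul : ∀ (r : ℝ) (a b : A), 0 ≤ r → a ≤ b → r • a ≤ r • b) {s : A} (hs : 0 ≤ s) :
    IsSelfMajorizing s ↔ ∀ x : A, ∃ m : ℕ, ∀ n : ℕ, |x| ⊓ n • s ≤ m • s := by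
  have hmono : ∀ {c d : ℝ}, c ≤ d → c • s ≤ d • s := fun {c d} h => by
    have := hsmul (d - c) 0 s (sub_nonneg.2 h) hs
    rwa [smul_zero, sub_smul, sub_nonneg] at this
  simp only [IsSelfMajorizing, IsMajorant, abs_of_nonneg hs]
  refine ⟨fun h x => ?_, fun h => ⟨hs, fun x => ?_⟩⟩
  · obtain ⟨c, -, hc⟩ := h.2 x
    obtain ⟨m, hm⟩ := exists_nat_ge c
    refine ⟨m, fun n => (hc n).trans ?_⟩
    rw [← Nat.cast_smul_eq_nsmul ℝ m s]
    exact hmono hm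
  · obtain ⟨m, hm⟩ := h x
    refine ⟨m + 1, by positivity, fun n => (hm n).trans ?_⟩
    rw [← Nat.cast_smul_eq_nsmul ℝ m s]
    exact hmono (by linarith)

variable [IsOrderedAddMonoid A]

theorem IsSelfMajorizing.of_le_of_le
    (hsmul : ∀ (r : ℝ) (a b : A), 0 ≤ r → a ≤ b → r • a ≤ r • b)
    {s r : A} (hs : 0 ≤ s) (hr : 0 ≤ r)
    (h : IsSelfMajorizing s) {k m : ℕ} (hsr : s ≤ k • r) (hrs : r ≤ m • s) :
    IsSelfMajorizing r := by
  rw [isSelfMajorizing_iff hsmul hs] at h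
  rw [isSelfMajorizing_iff hsmul hr]
  intro x
  obtain ⟨l, hl⟩ := h x
  refine ⟨l * k, fun n => ?_⟩
  calc |x| ⊓ n • r ≤ |x| ⊓ (n * m) • s :=
        inf_le_inf_left _ ((nsmul_le_nsmul_right hrs n).trans_eq (mul_nsmul' s n m).symm)
    _ ≤ l • s := hl _
    _ ≤ (l * k) • r := (nsmul_le_nsmul_right hsr l).trans_eq (mul_nsmul' r l k).symm

theorem IsSelfMajorizing.add
    (hsmul : ∀ (r : ℝ) (a b : A), 0 ≤ r → a ≤ b → r • a ≤ r • b)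
    {s t : A} (hs : 0 ≤ s) (ht : 0 ≤ t)
    (h : IsSelfMajorizing s) (h' : IsSelfMajorizing t) : IsSelfMajorizing (s + t) := by
  rw [isSelfMajorizing_iff hsmul hs] at h
  rw [isSelfMajorizing_iff hsmul ht] at h'
  rw [isSelfMajorizing_iff hsmul (add_nonneg hs ht)]
  intro x
  obtain ⟨k, hk⟩ := h x
  obtain ⟨l, hl⟩ := h' x
  refine ⟨k + l, fun n => ?_⟩
  rw [nsmul_add]
  calc |x| ⊓ (n • s + n • t) ≤ |x| ⊓ n • s + |x| ⊓ n • t :=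
        inf_add_le_inf_add_inf (abs_nonneg x) (nsmul_nonneg hs n) (nsmul_nonneg ht n)
    _ ≤ k • s + l • t := add_le_add (hk n) (hl n)
    _ ≤ (k + l) • s + (k + l) • t :=
        add_le_add (nsmul_le_nsmul_left hs (Nat.le_add_right k l))
          (nsmul_le_nsmul_left ht (Nat.le_add_left l k))
    _ = (k + l) • (s + t) := (nsmul_add _ _ _).symm

theorem IsSelfMajorizing.exists_posPart_inf_eq_zero
    (hsmul : ∀ (r : ℝ) (a b : A), 0 ≤ r → a ≤ b → r • a ≤ r • b)
    {s : A} (hs : 0 ≤ s)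
    (h : IsSelfMajorizing s) {x : A} (hx : 0 ≤ x) : ∃ m : ℕ, (x - m • s)⁺ ⊓ s = 0 := by
  obtain ⟨m, hm⟩ := (isSelfMajorizing_iff hsmul hs).1 h x
  refine ⟨m, posPart_inf_eq_zero hs ?_⟩
  have h1 := hm (m + 1)
  rw [abs_of_nonneg hx] at h1
  have h2 : (x - m • s) ⊓ s + m • s ≤ x ⊓ (m + 1) • s := by
    refine le_inf (le_sub_iff_add_le.1 inf_le_left) ?_
    rw [succ_nsmul']
    exact add_le_add_left inf_le_right _
  exact add_le_iff_nonpos_left.1 (h2.trans h1)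

theorem InPhi3.exists_abs_le
    (hsmul : ∀ (r : ℝ) (a b : A), 0 ≤ r → a ≤ b → r • a ≤ r • b)
    {φ : A} (h : InPhi3 φ) :
    ∃ s : A, 0 ≤ s ∧ IsSelfMajorizing s ∧ |φ| ≤ s := by
  obtain ⟨s, t, hs, ht, hs', ht', rfl⟩ := h
  refine ⟨s + t, add_nonneg hs ht, hs'.add hsmul hs ht ht', abs_le'.2 ⟨?_, ?_⟩⟩
  · exact (sub_le_self s ht).trans (le_add_of_nonneg_right ht)
  · rw [neg_sub]
    exact (sub_le_self t hs).trans (le_add_of_nonneg_left hs)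

theorem IsSelfMajorizing.inPhi3_of_abs_le
    (hsmul : ∀ (r : ℝ) (a b : A), 0 ≤ r → a ≤ b → r • a ≤ r • b)
    {s b : A} (hs : 0 ≤ s) (h : IsSelfMajorizing s) {m : ℕ}
    (hb : |b| ≤ m • s) : InPhi3 b := by
  have hb₁ : b ≤ m • s := (le_abs_self b).trans hb
  have hb₂ : -b ≤ m • s := (neg_le_abs b).trans hb
  have h₁ : s ≤ (m + 1) • s + b := by
    rw [succ_nsmul', add_assoc]
    exact le_add_of_nonneg_right (neg_le_iff_add_nonneg.1 hb₂)
  have h₂ : s ≤ (m + 1) • s := by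
    rw [succ_nsmul']
    exact le_add_of_nonneg_right (nsmul_nonneg hs m)
  refine ⟨(m + 1) • s + b, (m + 1) • s, hs.trans h₁, hs.trans h₂,
    h.of_le_of_le hsmul (k := 1) (m := m + 1 + m) hs (hs.trans h₁) (by rwa [one_nsmul]) ?_,
    h.of_le_of_le hsmul (k := 1) hs (hs.trans h₂) (by rwa [one_nsmul]) le_rfl,
    (add_sub_cancel_left _ _).symm⟩
  rw [add_nsmul _ (m + 1) m]
  exact add_le_add_right hb₁ _

end SelfMajorizing

section FAlgebra

variable {A : Type*} [Lattice A] [AddCommGroup A] [Module ℝ A] [Mul A]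

theorem IsLAlgebra.isOrderedAddMonoid (hA : IsLAlgebra A) : IsOrderedAddMonoid A where
  add_le_add_left a b h c := by simpa only [add_comm] using hA.add_le_add_left a b h c

namespace IsLAlgebra

theorem zero_mul (hA : IsLAlgebra A) (a : A) : 0 * a = 0 := by
  simpa using hA.smul_mul 0 0 a

theorem sub_mul (hA : IsLAlgebra A) (a b c : A) : (a - b) * c = a * c - b * c := by
  rw [eq_sub_iff_add_eq, ← hA.right_distrib, sub_add_cancel]

theorem mul_sub (hA : IsLAlgebra A) (a b c : A) : a * (b - c) = a * b - a * c := by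
  rw [eq_sub_iff_add_eq, ← hA.left_distrib, sub_add_cancel]

theorem nsmul_mul (hA : IsLAlgebra A) (n : ℕ) (a b : A) : (n • a) * b = n • (a * b) := by
  rw [← Nat.cast_smul_eq_nsmul ℝ, hA.smul_mul, Nat.cast_smul_eq_nsmul]

theorem mul_le_mul (hA : IsLAlgebra A) {a b c d : A} (hab : a ≤ b) (hcd : c ≤ d)
    (hc : 0 ≤ c) (hb : 0 ≤ b) : a * c ≤ b * d := by
  have := hA.isOrderedAddMonoid
  have h₁ := hA.mul_nonneg _ _ (sub_nonneg.2 hab) hc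
  have h₂ := hA.mul_nonneg _ _ hb (sub_nonneg.2 hcd)
  rw [hA.sub_mul, sub_nonneg] at h₁
  rw [hA.mul_sub, sub_nonneg] at h₂
  exact h₁.trans h₂

theorem mpow_nonneg (hA : IsLAlgebra A) {a : A} (ha : 0 ≤ a) (q : ℕ) : 0 ≤ mpow a (q + 1) := by
  induction q with
  | zero => exact ha
  | succ q ih => rw [mpow_add_two]; exact hA.mul_nonneg _ _ ih ha

theorem mpow_le_mpow (hA : IsLAlgebra A) {a b : A} (ha : 0 ≤ a) (hab : a ≤ b) (q : ℕ) :
    mpow a (q + 1) ≤ mpow b (q + 1) := by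
  induction q with
  | zero => exact hab
  | succ q ih =>
    rw [mpow_add_two, mpow_add_two]
    exact hA.mul_le_mul ih hab ha (hA.mpow_nonneg (ha.trans hab) q)

theorem mul_mpow (hA : IsLAlgebra A) (a : A) (q : ℕ) :
    a * mpow a (q + 1) = mpow a (q + 1) * a := by
  induction q with
  | zero => rfl
  | succ q ih => rw [mpow_add_two, ← hA.mul_assoc, ih]

end IsLAlgebra

namespace IsFAlgebra

theorem abs_mul (hA : IsFAlgebra A) (a b : A) : |a * b| = |a| * |b| := by
  have := hA.isOrderedAddMonoid
  have ha := posPart_nonneg a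
  have ha' := negPart_nonneg a
  have hb := posPart_nonneg b
  have hb' := negPart_nonneg b
  have da := posPart_inf_negPart_eq_zero a
  have db := posPart_inf_negPart_eq_zero b
  have left : ∀ {x y u v : A}, 0 ≤ u → 0 ≤ v → x ⊓ y = 0 → (x * u) ⊓ (y * v) = 0 :=
    fun {x y u v} hu hv h => by
      have h₁ := (hA.f_prop _ _ u h hu).1
      rw [inf_comm] at h₁ ⊢
      exact (hA.f_prop _ _ v h₁ hv).1
  have right : ∀ {x y u v : A}, 0 ≤ u → 0 ≤ v → x ⊓ y = 0 → (u * x) ⊓ (v * y) = 0 :=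
    fun {x y u v} hu hv h => by
      have h₁ := (hA.f_prop _ _ u h hu).2
      rw [inf_comm] at h₁ ⊢
      exact (hA.f_prop _ _ v h₁ hv).2
  have hpp := hA.mul_nonneg _ _ ha hb
  have hpn := hA.mul_nonneg _ _ ha hb'
  have hnp := hA.mul_nonneg _ _ ha' hb
  have hnn := hA.mul_nonneg _ _ ha' hb'
  have key : (a⁺ * b⁺ + a⁻ * b⁻) ⊓ (a⁺ * b⁻ + a⁻ * b⁺) = 0 := by
    refine add_inf_eq_zero hpp hnn (add_nonneg hpn hnp) ?_ ?_ <;> rw [inf_comm] <;>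
      refine add_inf_eq_zero hpn hnp (by assumption) ?_ ?_ <;> rw [inf_comm]
    · exact right ha ha db
    · exact left hb hb da
    · rw [inf_comm]; exact left hb' hb' da
    · rw [inf_comm]; exact right ha' ha' db
  have hab : a * b = (a⁺ * b⁺ + a⁻ * b⁻) - (a⁺ * b⁻ + a⁻ * b⁺) := by
    conv_lhs => rw [← posPart_sub_negPart a, ← posPart_sub_negPart b]
    rw [hA.sub_mul, hA.mul_sub, hA.mul_sub]
    abel
  rw [hab, abs_sub_of_inf_eq_zero key, ← posPart_add_negPart a, ← posPart_add_negPart b,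
    hA.right_distrib, hA.left_distrib, hA.left_distrib]
  abel

theorem abs_mpow (hA : IsFAlgebra A) (a : A) (q : ℕ) : |mpow a (q + 1)| = mpow |a| (q + 1) := by
  induction q with
  | zero => rfl
  | succ q ih => rw [mpow_add_two, mpow_add_two, hA.abs_mul, ih]

theorem eq_zero_of_inf_mpow_eq_zero (hA : IsFAlgebra A) (hsp : IsSemiprime A) {v w : A}
    (hv : 0 ≤ v) (hvw : v ≤ w) (q : ℕ) (h : v ⊓ mpow w (q + 2) = 0) : v = 0 := by
  have := hA.isOrderedAddMonoid
  have h₁ : mpow v (q + 2) ⊓ v = 0 :=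
    inf_eq_zero_of_le (inf_comm v _ ▸ h) hv (hA.mpow_nonneg hv (q + 1))
      (hA.mpow_le_mpow hv hvw (q + 1))
  rw [inf_comm] at h₁
  have h₂ := (hA.f_prop _ _ (mpow v (q + 1)) h₁ (hA.mpow_nonneg hv q)).2
  rw [← mpow_add_two, inf_idem] at h₂
  exact hsp v (q + 2) (Nat.succ_pos _) h₂

theorem exists_le_nsmul_of_mpow_le (hA : IsFAlgebra A) (hsp : IsSemiprime A) {s w : A}
    (hs : 0 ≤ s) (h : IsSelfMajorizing s) (hw : 0 ≤ w) (q : ℕ) (hws : mpow w (q + 2) ≤ s) :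
    ∃ m : ℕ, w ≤ m • s := by
  have := hA.isOrderedAddMonoid
  obtain ⟨m, hm⟩ := h.exists_posPart_inf_eq_zero hA.smul_le_smul hs hw
  refine ⟨m, ?_⟩
  have hv := posPart_nonneg (w - m • s)
  have hvw : (w - m • s)⁺ ≤ w := sup_le (sub_le_self w (nsmul_nonneg hs m)) hw
  rw [inf_comm] at hm
  have h₁ := inf_eq_zero_of_le hm hv (hA.mpow_nonneg hw (q + 1)) hws
  rw [inf_comm] at h₁
  have h₂ := hA.eq_zero_of_inf_mpow_eq_zero hsp hv hvw q h₁
  exact sub_nonpos.1 (posPart_eq_zero.1 h₂)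

theorem exists_mul_le_nsmul (hA : IsFAlgebra A) {s d : A} (hs : 0 ≤ s)
    (h : IsSelfMajorizing s) (hd : 0 ≤ d) : ∃ m : ℕ, s * d ≤ m • s := by
  have := hA.isOrderedAddMonoid
  have hsd := hA.mul_nonneg _ _ hs hd
  obtain ⟨m, hm⟩ := h.exists_posPart_inf_eq_zero hA.smul_le_smul hs hsd
  refine ⟨m, ?_⟩
  have hv := posPart_nonneg (s * d - m • s)
  have hle : (s * d - m • s)⁺ ≤ s * d := sup_le (sub_le_self _ (nsmul_nonneg hs m)) hsd
  rw [inf_comm] at hm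
  have h₁ := (hA.f_prop _ _ d hm hd).1
  have h₂ := inf_eq_zero_of_le h₁ hv hv hle
  rw [inf_idem] at h₂
  exact sub_nonpos.1 (posPart_eq_zero.1 h₂)

theorem posPart_mul_eq_zero (hA : IsFAlgebra A) {u d : A} (hd : 0 ≤ d) (h : u * d ≤ 0) :
    u⁺ * d = 0 := by
  have := hA.isOrderedAddMonoid
  have h₁ := (hA.f_prop _ _ d (posPart_inf_negPart_eq_zero u) hd).1
  rw [inf_comm] at h₁
  have h₂ := (hA.f_prop _ _ d h₁ hd).1
  rw [← posPart_sub_negPart u, hA.sub_mul, sub_nonpos] at h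
  rwa [inf_eq_right.2 h] at h₂

theorem exists_mpow_le_nsmul (hA : IsFAlgebra A) (hsp : IsSemiprime A) {b : A} (hb : 0 ≤ b)
    (q : ℕ) (h : IsSelfMajorizing (mpow b (q + 2))) : ∃ m : ℕ, mpow b (q + 2) ≤ m • b := by
  have := hA.isOrderedAddMonoid
  have hd := hA.mpow_nonneg hb q
  have hφ := hA.mpow_nonneg hb (q + 1)
  obtain ⟨m, hm⟩ := hA.exists_mul_le_nsmul hφ h hd
  refine ⟨m, sub_nonpos.1 (posPart_eq_zero.1 ?_)⟩
  have hu : (mpow b (q + 2) - m • b) * mpow b (q + 1) ≤ 0 := by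
    rwa [hA.sub_mul, hA.nsmul_mul, hA.mul_mpow, ← mpow_add_two, sub_nonpos]
  have hv := posPart_nonneg (mpow b (q + 2) - m • b)
  have hle : (mpow b (q + 2) - m • b)⁺ ≤ mpow b (q + 2) :=
    sup_le (sub_le_self _ (nsmul_nonneg hb m)) hφ
  have h₁ := hA.mul_le_mul le_rfl hle hv hv
  conv_rhs at h₁ => rw [mpow_add_two b q, ← hA.mul_assoc]
  rw [← mpow_add_two, hA.posPart_mul_eq_zero hd hu, hA.zero_mul] at h₁
  refine hsp _ 2 two_pos (le_antisymm ?_ (hA.mpow_nonneg hv 1))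
  rwa [mpow_add_two, mpow_one]

end IsFAlgebra

end FAlgebra

/-- In a semiprime f-algebra, a p-th root of an element of `Φ₃(𝒜)` again lies in
`Φ₃(𝒜)`; in particular a positive p-th root of a positive self-majorizing element is
self-majorizing. -/
theorem stmt9 {A : Type*} [Lattice A] [AddCommGroup A] [Module ℝ A] [Mul A]
    (hA : IsFAlgebra A) (hsp : IsSemiprime A) (p : ℕ) (hp : 2 ≤ p) :
    (∀ φ b : A, InPhi3 φ → mpow b p = φ → InPhi3 b) ∧
    (∀ φ b : A, 0 < φ → IsSelfMajorizing φ → 0 ≤ b → mpow b p = φ → IsSelfMajorizing b) := by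
  obtain ⟨q, rfl⟩ := Nat.exists_eq_add_of_le' hp
  have := hA.isOrderedAddMonoid
  refine ⟨?_, ?_⟩
  · rintro φ b hφ rfl
    obtain ⟨s, hs, hs', hle⟩ := hφ.exists_abs_le hA.smul_le_smul
    rw [hA.abs_mpow] at hle
    obtain ⟨m, hm⟩ := hA.exists_le_nsmul_of_mpow_le hsp hs hs' (abs_nonneg b) q hle
    exact hs'.inPhi3_of_abs_le hA.smul_le_smul hs hm
  · rintro φ b hφ hφ' hb rfl
    obtain ⟨m, hm⟩ := hA.exists_le_nsmul_of_mpow_le hsp hφ.le hφ' hb q le_rfl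
    obtain ⟨k, hk⟩ := hA.exists_mpow_le_nsmul hsp hb q hφ'
    exact hφ'.of_le_of_le hA.smul_le_smul hφ.le hb hk hm

end FiniteElementsPaper
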